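/- Let K be an algebraically closed field of characteristic zero and let G be a finite subgroup of PGL(2,K) that is not isomorphic to a dihedral group D_m with m even. Then any two maximal cyclic subgroups of G having the same order are conjugate by an element of G. -/

import Mathlib

open Matrix

/-- The projective general linear group `PGL(2,K)`: the quotient of `GL(2,K)` by its
center, the subgroup of nonzero scalar matrices. -/
abbrev PGL2 (K : Type*) [Field K] : Type _ :=
  GL (Fin 2) K ⧸ Subgroup.center (GL (Fin 2) K)

/-- A maximal cyclic subgroup of a group `G`: a cyclic subgroup not properly contained in
any other cyclic subgroup of `G`. -/
def IsMaximalCyclic {G : Type*} [Group G] (C : Subgroup G) : Prop :=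
  IsCyclic C ∧ ∀ C' : Subgroup G, IsCyclic C' → C ≤ C' → C = C'

section AbstractAction

open MulAction

variable {G X : Type*} [Group G] [MulAction G X]

lemma smul_mem_orbit_iff_aux (g : G) (x p : X) : g • x ∈ orbit G p ↔ x ∈ orbit G p := by
  rw [← orbit_eq_iff, ← orbit_eq_iff, orbit_smul]

/-- Free action: the order of the group divides the size of an invariant set. -/
lemma card_dvd_ncard_of_free (C : Subgroup G) (S : Set X)
    (hinv : ∀ g ∈ C, ∀ x ∈ S, g • x ∈ S)
    (hfree : ∀ g ∈ C, ∀ x ∈ S, g • x = x → g = 1) : Nat.card C ∣ S.ncard := by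
  let T : SubMulAction C X := ⟨S, fun c x hx => hinv c.1 c.2 x hx⟩
  have h : ∀ b : T, stabilizer C b = ⊥ := by
    intro b
    rw [eq_bot_iff]
    intro c hc
    have h1 : (c.1 • b.1 : X) = b.1 := congrArg Subtype.val (mem_stabilizer_iff.1 hc)
    have := hfree c.1 c.2 b.1 b.2 h1
    rw [Subgroup.mem_bot]
    exact Subtype.ext this
  have e := Nat.card_congr (selfEquivOrbitsQuotientProd h)
  rw [Nat.card_prod] at e
  have e2 : S.ncard = Nat.card T := (Nat.card_coe_set_eq S).symm
  rw [e2, e]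
  exact Dvd.intro_left _ rfl

/-- An element swapping two points is an involution. -/
lemma swap_sq
    (hfix : ∀ g : G, g ≠ 1 → ∃ p q : X, p ≠ q ∧ ∀ x, g • x = x ↔ x = p ∨ x = q)
    (g : G) (x y : X) (hxy : x ≠ y) (h1 : g • x = y) (h2 : g • y = x) : g * g = 1 := by
  by_contra hne
  have hg : g ≠ 1 := by
    rintro rfl
    exact hne (by simp)
  obtain ⟨p, q, hpq, h⟩ := hfix g hg
  obtain ⟨p', q', hpq', h'⟩ := hfix (g * g) hne
  have hx := (h' x).1 (by rw [mul_smul, h1, h2])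
  have hy := (h' y).1 (by rw [mul_smul, h2, h1])
  have gp := (h p).2 (Or.inl rfl)
  have hp := (h' p).1 (by rw [mul_smul, gp, gp])
  have : p = x ∨ p = y := by grind
  rcases this with rfl | rfl
  · exact hxy (gp.symm.trans h1)
  · exact hxy (h2.symm.trans gp)

lemma IsMaximalCyclic.exists_points
    (hfix : ∀ g : G, g ≠ 1 → ∃ p q : X, p ≠ q ∧ ∀ x, g • x = x ↔ x = p ∨ x = q)
    (hcyc : ∀ x : X, IsCyclic (stabilizer G x))
    (C : Subgroup G) (hC : IsMaximalCyclic C) (hne : C ≠ ⊥) :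
    ∃ p q : X, p ≠ q ∧ C = stabilizer G p ∧ C = stabilizer G q ∧
      ∀ g ∈ C, g ≠ 1 → ∀ x, g • x = x → x = p ∨ x = q := by
  obtain ⟨c, hc⟩ := (Subgroup.isCyclic_iff_exists_zpowers_eq_top C).1 hC.1
  have hc1 : c ≠ 1 := by
    rintro rfl
    exact hne (by rw [← hc, Subgroup.zpowers_one_eq_bot])
  obtain ⟨p, q, hpq, h⟩ := hfix c hc1
  have key : ∀ x : X, c • x = x → C = stabilizer G x := by
    intro x hx
    apply hC.2 _ (hcyc x)
    rw [← hc, Subgroup.zpowers_le]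
    exact hx
  have e1 := key p ((h p).2 (Or.inl rfl))
  have e2 := key q ((h q).2 (Or.inr rfl))
  refine ⟨p, q, hpq, e1, e2, ?_⟩
  intro g hg hg1 x hx
  obtain ⟨p', q', hpq', h'⟩ := hfix g hg1
  have a1 := (h' p).1 (by rw [e1] at hg; exact hg)
  have a2 := (h' q).1 (by rw [e2] at hg; exact hg)
  have a3 := (h' x).1 hx
  grind

/-- Recognition of dihedral groups. -/
lemma nonempty_dihedral [Finite G] (c t : G) (hcard : Nat.card G = 2 * orderOf c)
    (ht : t * t = 1) (htc : t ∉ Subgroup.zpowers c) (hct : (c * t) * (c * t) = 1) :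
    Nonempty (G ≃* DihedralGroup (orderOf c)) := by
  have hinv : t * c * t⁻¹ = c⁻¹ := by
    have h1 : t⁻¹ = t := inv_eq_of_mul_eq_one_left ht
    rw [h1, eq_inv_iff_mul_eq_one, ← mul_eq_one_comm]
    simpa [mul_assoc] using hct
  have hz : ∀ k : ℤ, c ^ k * t = t * c ^ (-k) := by
    intro k
    have : t * c ^ (-k) * t⁻¹ = c ^ k := by
      rw [← conj_zpow, hinv]; simp
    rw [← this]; simp
  set m := orderOf c with hm
  have hm0 : 0 < m := orderOf_pos c
  have : NeZero m := ⟨hm0.ne'⟩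
  have hcast : ∀ (a : ℤ) (i : ZMod m), ((a : ZMod m) = i) → c ^ (i.cast : ℤ) = c ^ a := by
    intro a i h
    rw [zpow_eq_zpow_iff_modEq, ← ZMod.intCast_eq_intCast_iff, ZMod.intCast_zmod_cast, h]
  let f : DihedralGroup m → G := fun d => match d with
    | DihedralGroup.r i => c ^ (i.cast : ℤ)
    | DihedralGroup.sr i => t * c ^ (i.cast : ℤ)
  have hmul : ∀ a b, f (a * b) = f a * f b := by
    rintro (i | i) (j | j)
    · simp only [DihedralGroup.r_mul_r, f]
      rw [← _root_.zpow_add]; apply hcast; simp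
    · simp only [DihedralGroup.r_mul_sr, f]
      rw [← mul_assoc, hz, mul_assoc, ← _root_.zpow_add]; congr 1; apply hcast; simp; ring
    · simp only [DihedralGroup.sr_mul_r, f]
      rw [mul_assoc, ← _root_.zpow_add]; congr 1; apply hcast; simp
    · simp only [DihedralGroup.sr_mul_sr, f]
      rw [mul_assoc, ← mul_assoc (c ^ _) t, hz, ← mul_assoc, ← mul_assoc, ht, one_mul, ← _root_.zpow_add]
      apply hcast; simp; ring
  let F : DihedralGroup m →* G := MonoidHom.mk' f hmul
  have hinj : Function.Injective F := by
    rw [injective_iff_map_eq_one]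
    rintro (i | i) hi
    · have h0 : c ^ (i.cast : ℤ) = c ^ (0 : ℤ) := by rw [zpow_zero]; exact hi
      rw [zpow_eq_zpow_iff_modEq, ← ZMod.intCast_eq_intCast_iff, ZMod.intCast_zmod_cast] at h0
      rw [h0]; simp
    · exfalso
      have h0 : t * c ^ (i.cast : ℤ) = 1 := hi
      apply htc
      rw [eq_inv_of_mul_eq_one_left h0]
      exact inv_mem (Subgroup.zpow_mem _ (Subgroup.mem_zpowers c) _)
  have hb := hinj.bijective_of_nat_card_le (by rw [DihedralGroup.nat_card, hcard])
  exact ⟨(MulEquiv.ofBijective F hb).symm⟩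

/-- Counting of points with nontrivial stabilizer. -/
lemma burnside_count [Finite G]
    (hfix : ∀ g : G, g ≠ 1 → ∃ p q : X, p ≠ q ∧ ∀ x, g • x = x ↔ x = p ∨ x = q) :
    ∃ (F : Set X) (r : ℕ), F.Finite ∧ (∀ x, x ∈ F ↔ ∃ g : G, g ≠ 1 ∧ g • x = x) ∧
      F.ncard + 2 * Nat.card G = r * Nat.card G + 2 ∧ F.ncard + 2 ≤ 2 * Nat.card G := by
  classical
  have := Fintype.ofFinite G
  let F : Set X := {x | ∃ g : G, g ≠ 1 ∧ g • x = x}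
  have hF : F.Finite := by
    have : F ⊆ ⋃ g : {g : G // g ≠ 1}, {x | g.1 • x = x} := by
      rintro x ⟨g, hg, hx⟩
      exact Set.mem_iUnion.2 ⟨⟨g, hg⟩, hx⟩
    refine (Set.finite_iUnion ?_).subset this
    rintro ⟨g, hg⟩
    obtain ⟨p, q, -, h⟩ := hfix g hg
    refine (Set.toFinite {p, q}).subset ?_
    intro x hx
    exact (h x).1 hx
  let T : SubMulAction G X := ⟨F, by
    rintro g x ⟨k, hk, hx⟩
    refine ⟨g * k * g⁻¹, ?_, ?_⟩
    · intro h
      apply hk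
      simpa using h
    · simp [mul_smul, hx]⟩
  have : Finite T := hF
  have := Fintype.ofFinite T
  have hTF : Fintype.card T = F.ncard := by
    rw [← Nat.card_eq_fintype_card]; exact Nat.card_coe_set_eq F
  have hsum : ∑ g : G, Fintype.card (fixedBy T g) = F.ncard + 2 * (Nat.card G - 1) := by
    rw [← Finset.add_sum_erase _ _ (Finset.mem_univ (1 : G))]
    congr 1
    · rw [← hTF]
      apply Fintype.card_congr
      simp only [fixedBy_one_eq_univ]
      exact Equiv.Set.univ _
    · rw [Finset.sum_congr rfl (g := fun _ => 2)]
      · rw [Finset.sum_const, Finset.card_erase_of_mem (Finset.mem_univ _), Finset.card_univ,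
          Nat.card_eq_fintype_card]
        simp [mul_comm]
      · intro g hg
        obtain ⟨p, q, hpq, h⟩ := hfix g (Finset.ne_of_mem_erase hg)
        have hp : p ∈ F := ⟨g, Finset.ne_of_mem_erase hg, (h p).2 (Or.inl rfl)⟩
        have hq : q ∈ F := ⟨g, Finset.ne_of_mem_erase hg, (h q).2 (Or.inr rfl)⟩
        have : fixedBy T g = {(⟨p, hp⟩ : T), ⟨q, hq⟩} := by
          ext x
          rw [mem_fixedBy]
          have h1 : g • x = x ↔ g • x.1 = x.1 := by
            rw [Subtype.ext_iff]; rfl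
          rw [h1, h x.1]
          simp [Subtype.ext_iff]
        rw [← Nat.card_eq_fintype_card, Nat.card_coe_set_eq, this, Set.ncard_pair]
        simpa [Subtype.ext_iff] using hpq
  have : Fintype (Quotient (orbitRel G T)) := Fintype.ofFinite _
  have hb := sum_card_fixedBy_eq_card_orbits_mul_card_group G T
  have hN : 0 < Nat.card G := Nat.card_pos
  refine ⟨F, Fintype.card (Quotient (orbitRel G T)), hF, fun x => Iff.rfl, ?_, ?_⟩
  · rw [hsum, ← Nat.card_eq_fintype_card (α := G)] at hb
    omega
  · have hdc := Finset.sum_card_bipartiteAbove_eq_sum_card_bipartiteBelow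
      (fun (g : G) (x : T) => g • x = x) (s := Finset.univ) (t := Finset.univ)
    have e1 : ∀ g : G, (Finset.bipartiteAbove (fun (g : G) (x : T) => g • x = x)
        Finset.univ g).card = Fintype.card (fixedBy T g) := by
      intro g
      rw [Fintype.card_subtype]
      rfl
    have e2 : ∀ x : T, 2 ≤ (Finset.bipartiteBelow (fun (g : G) (x : T) => g • x = x)
        Finset.univ x).card := by
      rintro ⟨x, k, hk, hx⟩
      have : ({1, k} : Finset G) ⊆ Finset.bipartiteBelow (fun (g : G) (x : T) => g • x = x)
        Finset.univ ⟨x, k, hk, hx⟩ := by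
        intro g hg
        simp only [Finset.mem_insert, Finset.mem_singleton] at hg
        simp only [Finset.bipartiteBelow, Finset.mem_filter, Finset.mem_univ, true_and]
        rcases hg with rfl | rfl
        · exact one_smul _ _
        · exact Subtype.ext hx
      have h2 := Finset.card_le_card this
      rwa [Finset.card_pair (Ne.symm hk)] at h2
    simp only [e1, hsum] at hdc
    have e3 := Finset.card_nsmul_le_sum Finset.univ _ 2 (fun x _ => e2 x)
    rw [← hdc, Finset.card_univ, hTF, smul_eq_mul] at e3
    omega

theorem abstract_conj [Finite G]
    (hfix : ∀ g : G, g ≠ 1 → ∃ p q : X, p ≠ q ∧ ∀ x, g • x = x ↔ x = p ∨ x = q)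
    (hcyc : ∀ x : X, IsCyclic (stabilizer G x))
    (hG : ∀ m : ℕ, Even m → ¬ Nonempty (G ≃* DihedralGroup m))
    (C₁ C₂ : Subgroup G) (h₁ : IsMaximalCyclic C₁) (h₂ : IsMaximalCyclic C₂)
    (hcard : Nat.card C₁ = Nat.card C₂) :
    ∃ g : G, Subgroup.map (MulAut.conj g).toMonoidHom C₁ = C₂ := by
  by_cases hb : C₁ = ⊥
  · have hb2 : C₂ = ⊥ := by
      rw [← Subgroup.card_eq_one, ← hcard, hb, Subgroup.card_bot]
    exact ⟨1, by rw [hb, hb2, Subgroup.map_bot]⟩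
  have hb2 : C₂ ≠ ⊥ := by
    rintro rfl
    rw [Subgroup.card_bot, Subgroup.card_eq_one] at hcard
    exact hb hcard
  obtain ⟨p, q, hpq, ep, eq, hf⟩ := h₁.exists_points hfix hcyc C₁ hb
  obtain ⟨p', q', hpq', ep', eq', hf'⟩ := h₂.exists_points hfix hcyc C₂ hb2
  by_cases c1 : p' ∈ orbit G p
  · obtain ⟨g, rfl⟩ := c1
    exact ⟨g, by rw [ep', ep]; exact (stabilizer_smul_eq_stabilizer_map_conj g p).symm⟩
  by_cases c2 : p' ∈ orbit G q
  · obtain ⟨g, rfl⟩ := c2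
    exact ⟨g, by rw [ep', eq]; exact (stabilizer_smul_eq_stabilizer_map_conj g q).symm⟩
  exfalso
  have fin : ∀ x : X, (orbit G x).Finite := fun x => Set.finite_range _
  have hn2 : 2 ≤ Nat.card C₁ := by
    have := Subgroup.one_lt_card_iff_ne_bot C₁ |>.2 hb
    omega
  have o1 : (orbit G p).ncard * Nat.card C₁ = Nat.card G := by
    rw [← index_stabilizer, ep]; exact Subgroup.index_mul_card _
  have o2 : (orbit G p').ncard * Nat.card C₁ = Nat.card G := by
    rw [← index_stabilizer, hcard, ep']; exact Subgroup.index_mul_card _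
  have o12 : (orbit G p).ncard = (orbit G p').ncard :=
    Nat.eq_of_mul_eq_mul_right (by omega) (o1.trans o2.symm)
  have d2 : Nat.card C₁ ∣ (orbit G p').ncard := by
    apply card_dvd_ncard_of_free
    · intro g _ x hx
      exact (smul_mem_orbit_iff_aux _ _ _).2 hx
    · intro g hg x hx hgx
      by_contra hg1
      rcases hf g hg hg1 x hgx with rfl | rfl
      · exact c1 (mem_orbit_symm.1 hx)
      · exact c2 (mem_orbit_symm.1 hx)
  have d1 : Nat.card C₁ ∣ (orbit G p \ {p, q}).ncard := by
    apply card_dvd_ncard_of_free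
    · rintro g hg x ⟨hx, hx2⟩
      refine ⟨(smul_mem_orbit_iff_aux _ _ _).2 hx, ?_⟩
      have gp : g⁻¹ • p = p := by
        have := inv_mem hg
        rw [ep] at this; exact this
      have gq : g⁻¹ • q = q := by
        have := inv_mem hg
        rw [eq] at this; exact this
      rintro (h | h)
      · apply hx2; left
        rw [← gp, ← h, inv_smul_smul]
      · apply hx2; right
        rw [Set.mem_singleton_iff] at h ⊢
        rw [← gq, ← h, inv_smul_smul]
    · rintro g hg x ⟨hx, hx2⟩ hgx
      by_contra hg1
      exact hx2 (hf g hg hg1 x hgx)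
  have hpm : p ∈ orbit G p := mem_orbit_self p
  have hqm : q ∈ orbit G p := by
    by_contra hq
    have : orbit G p \ {p, q} = orbit G p \ {p} := by
      ext x
      simp only [Set.mem_sdiff, Set.mem_insert_iff, Set.mem_singleton_iff]
      grind
    rw [this] at d1
    have h3 := Set.ncard_sdiff_singleton_add_one hpm (fin p)
    rw [← o12, ← h3] at d2
    have := (Nat.dvd_add_right d1).1 d2
    have := Nat.le_of_dvd one_pos this
    omega
  have hn : Nat.card C₁ = 2 := by
    have h3 := Set.ncard_sdiff_add_ncard_of_subset (s := {p, q}) (t := orbit G p)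
      (by rintro x (rfl | rfl); exacts [hpm, hqm]) (fin p)
    rw [Set.ncard_pair hpq] at h3
    rw [← o12, ← h3] at d2
    have := (Nat.dvd_add_right d1).1 d2
    have := Nat.le_of_dvd two_pos this
    omega
  rw [hn] at d2 o1 o2
  obtain ⟨F, r, hFf, hF, hb1, hb2⟩ := burnside_count (G := G) (X := X) hfix
  have hsub : ∀ x, (∃ g : G, g ≠ 1 ∧ g • x = x) → orbit G x ⊆ F := by
    rintro x ⟨k, hk, hx⟩ _ ⟨g, rfl⟩
    rw [hF]
    refine ⟨g * k * g⁻¹, ?_, ?_⟩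
    · intro h
      apply hk
      simpa using h
    · simp [mul_smul, hx]
  obtain ⟨t, htC, ht1⟩ : ∃ g ∈ C₁, g ≠ 1 := by
    by_contra! h
    exact hb ((Subgroup.eq_bot_iff_forall _).2 h)
  obtain ⟨t', htC', ht1'⟩ : ∃ g ∈ C₂, g ≠ 1 := by
    by_contra! h
    exact ‹C₂ ≠ ⊥› ((Subgroup.eq_bot_iff_forall _).2 h)
  have s1 := hsub p ⟨t, ht1, by rw [ep] at htC; exact htC⟩
  have s2 := hsub p' ⟨t', ht1', by rw [ep'] at htC'; exact htC'⟩
  have hdisj : Disjoint (orbit G p) (orbit G p') := by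
    rw [Set.disjoint_left]
    intro x hx hx'
    apply c1
    rw [← orbit_eq_iff] at hx hx' ⊢
    rw [← hx', hx]
  have hU : (orbit G p ∪ orbit G p').ncard = Nat.card G := by
    rw [Set.ncard_union_eq hdisj (fin p) (fin p')]; omega
  have hD := Set.ncard_sdiff_add_ncard_of_subset (Set.union_subset s1 s2) hFf
  rw [hU] at hD
  have hN4 : 4 ≤ Nat.card G := by
    have : 0 < Nat.card G := Nat.card_pos
    omega
  have hr : r = 3 := by
    have h3 : r < 4 := by
      by_contra h
      have : 4 * Nat.card G ≤ r * Nat.card G := Nat.mul_le_mul_right _ (by omega)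
      omega
    have h4 : 2 < r := by
      by_contra h
      have : r * Nat.card G ≤ 2 * Nat.card G := Nat.mul_le_mul_right _ (by omega)
      omega
    omega
  subst hr
  have hD2 : (F \ (orbit G p ∪ orbit G p')).ncard = 2 := by omega
  obtain ⟨R, S, hRS, hE⟩ := Set.ncard_eq_two.1 hD2
  have hinv : ∀ g : G, ∀ x, (x = R ∨ x = S) → (g • x = R ∨ g • x = S) := by
    intro g x hx
    have hx : x ∈ F \ (orbit G p ∪ orbit G p') := by rw [hE]; exact hx
    have : g • x ∈ F \ (orbit G p ∪ orbit G p') := by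
      obtain ⟨hxF, hxo⟩ := hx
      refine ⟨hsub x ((hF x).1 hxF) (mem_orbit x g), ?_⟩
      rintro (h | h)
      · exact hxo (Or.inl ((smul_mem_orbit_iff_aux _ _ _).1 h))
      · exact hxo (Or.inr ((smul_mem_orbit_iff_aux _ _ _).1 h))
    rw [hE] at this
    exact this
  have hswap : ∀ g : G, g • R ≠ R → g • R = S ∧ g • S = R := by
    intro g hg
    have a := (hinv g R (Or.inl rfl)).resolve_left hg
    refine ⟨a, (hinv g S (Or.inr rfl)).resolve_right ?_⟩
    intro h
    exact hRS (smul_left_cancel g (a.trans h.symm))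
  have hsq : ∀ g : G, g • R ≠ R → g * g = 1 := by
    intro g hg
    obtain ⟨a, b⟩ := hswap g hg
    exact swap_sq hfix g R S hRS a b
  have htR : t • R ≠ R := by
    intro h
    have hR : R ∈ F \ (orbit G p ∪ orbit G p') := by rw [hE]; exact Or.inl rfl
    apply hR.2
    left
    rcases hf t htC ht1 R h with rfl | rfl
    · exact hpm
    · exact hqm
  obtain ⟨c, hc⟩ := (Subgroup.isCyclic_iff_exists_zpowers_eq_top _).1 (hcyc R)
  have horb : orbit G R = {R, S} := by
    ext x
    constructor
    · rintro ⟨g, rfl⟩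
      exact hinv g R (Or.inl rfl)
    · rintro (rfl | rfl)
      · exact mem_orbit_self _
      · exact ⟨t, (hswap t htR).1⟩
  have hcd : Nat.card G = 2 * orderOf c := by
    rw [← Subgroup.index_mul_card (stabilizer G R), index_stabilizer, horb, Set.ncard_pair hRS,
      ← hc, Nat.card_zpowers]
  refine hG (orderOf c) ?_ (nonempty_dihedral c t hcd (hsq t htR) ?_ (hsq _ ?_))
  · rw [even_iff_two_dvd]
    omega
  · rw [hc]; exact htR
  · have hcR : c • R = R := by
      have := Subgroup.mem_zpowers c
      rw [hc] at this; exact this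
    rw [mul_smul, (hswap t htR).1]
    intro h
    rw [← hcR] at h
    exact hRS (smul_left_cancel c h).symm

end AbstractAction

section Concrete

open LinearAlgebra.Projectivization MulAction

/-- The action of `PGL2 K` on the projective line. -/
instance pgl2Action (K : Type*) [Field K] : MulAction (PGL2 K) (ℙ K (Fin 2 → K)) :=
  inferInstanceAs (MulAction (Matrix.ProjGenLinGroup (Fin 2) K) (ℙ K (Fin 2 → K)))

variable {K : Type*} [Field K]

lemma pgl2_smul_eq_iff (M : GL (Fin 2) K) (v : Fin 2 → K) (hv : v ≠ 0) :
    (QuotientGroup.mk M : PGL2 K) • Projectivization.mk K v hv = Projectivization.mk K v hv ↔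
      ∃ a : K, M.val *ᵥ v = a • v := by
  have h : (QuotientGroup.mk M : PGL2 K) • Projectivization.mk K v hv =
      Projectivization.mk K (M • v) ((smul_ne_zero_iff_ne M).2 hv) := rfl
  rw [h, Projectivization.mk_eq_mk_iff']
  constructor
  · rintro ⟨a, ha⟩
    exact ⟨a, ha.symm⟩
  · rintro ⟨a, ha⟩
    exact ⟨a, ha.symm⟩

lemma cayley_two (A : Matrix (Fin 2) (Fin 2) K) (a b : K) (h1 : a + b = A.trace)
    (h2 : a * b = A.det) : (A - a • 1) * (A - b • 1) = 0 := by
  rw [Matrix.trace_fin_two] at h1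
  rw [Matrix.det_fin_two] at h2
  ext i j
  fin_cases i <;> fin_cases j <;> simp [Matrix.mul_apply, Fin.sum_univ_two] <;> grind

lemma mk_eq_one_of_scalar (M : GL (Fin 2) K) (k : K) (h : M.val = k • 1) :
    (QuotientGroup.mk M : PGL2 K) = 1 := by
  rw [QuotientGroup.eq_one_iff, Matrix.GeneralLinearGroup.mem_center_iff_val_mem_range_scalar]
  exact ⟨k, by rw [h, Matrix.scalar_apply, Matrix.smul_one_eq_diagonal]⟩

lemma scalar_of_mk_eq_one (M : GL (Fin 2) K) (h : (QuotientGroup.mk M : PGL2 K) = 1) :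
    ∃ k : K, M.val = k • 1 := by
  rw [QuotientGroup.eq_one_iff,
    Matrix.GeneralLinearGroup.mem_center_iff_val_mem_range_scalar] at h
  obtain ⟨k, hk⟩ := h
  exact ⟨k, by rw [← hk, Matrix.scalar_apply, Matrix.smul_one_eq_diagonal]⟩

lemma pow_unipotent (A : Matrix (Fin 2) (Fin 2) K) (a : K)
    (h : (A - a • 1) * (A - a • 1) = 0) (n : ℕ) :
    A ^ (n + 1) = (a ^ (n + 1)) • (1 : Matrix (Fin 2) (Fin 2) K) +
      ((n + 1 : K) * a ^ n) • (A - a • 1) := by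
  set N := A - a • (1 : Matrix (Fin 2) (Fin 2) K) with hN
  have hA : A = a • 1 + N := by rw [hN]; abel
  induction n with
  | zero => simp [hA]
  | succ n ih =>
    rw [pow_succ, ih]
    nth_rewrite 1 [hA]
    simp only [add_mul, mul_add, smul_mul_assoc, mul_smul_comm, one_mul, mul_one, h, smul_zero,
      smul_smul, smul_add, add_zero]
    push_cast
    module

/-- A finite-order class with a double eigenvalue is trivial. -/
lemma mk_eq_one_of_double [CharZero K] (M : GL (Fin 2) K) (a : K)
    (hfin : IsOfFinOrder (QuotientGroup.mk M : PGL2 K))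
    (h1 : a + a = M.val.trace) (h2 : a * a = M.val.det) : (QuotientGroup.mk M : PGL2 K) = 1 := by
  have ha : a ≠ 0 := by
    rintro rfl
    have : IsUnit M.val.det := (Matrix.isUnit_iff_isUnit_det _).1 M.isUnit
    rw [← h2] at this
    simp at this
  obtain ⟨n, hn, hp⟩ := isOfFinOrder_iff_pow_eq_one.1 hfin
  obtain ⟨m, rfl⟩ : ∃ m, n = m + 1 := ⟨n - 1, by omega⟩
  rw [← QuotientGroup.mk_pow] at hp
  obtain ⟨k, hk⟩ := scalar_of_mk_eq_one _ hp
  rw [Units.val_pow_eq_pow_val, pow_unipotent M.val a (cayley_two _ _ _ h1 h2) m] at hk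
  have hne : ((m + 1 : K) * a ^ m) ≠ 0 :=
    mul_ne_zero (by exact_mod_cast Nat.succ_ne_zero m) (pow_ne_zero _ ha)
  have h3 : ((m + 1 : K) * a ^ m) • (M.val - a • 1) =
      (k - a ^ (m + 1)) • (1 : Matrix (Fin 2) (Fin 2) K) := by
    rw [sub_smul, ← hk]; abel
  have h4 : M.val - a • 1 =
      (((m + 1 : K) * a ^ m)⁻¹ * (k - a ^ (m + 1))) • (1 : Matrix (Fin 2) (Fin 2) K) := by
    rw [mul_smul, ← h3, smul_smul, inv_mul_cancel₀ hne, one_smul]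
  apply mk_eq_one_of_scalar M (((m + 1 : K) * a ^ m)⁻¹ * (k - a ^ (m + 1)) + a)
  rw [add_smul, ← h4]; abel

lemma det_sub_smul_one (A : Matrix (Fin 2) (Fin 2) K) (a : K) :
    (A - a • 1).det = a * a - A.trace * a + A.det := by
  simp [Matrix.det_fin_two, Matrix.trace_fin_two]
  ring

lemma mulVec_sub_smul (A : Matrix (Fin 2) (Fin 2) K) (a : K) (v : Fin 2 → K) :
    (A - a • 1) *ᵥ v = A *ᵥ v - a • v := by
  rw [Matrix.sub_mulVec, Matrix.smul_mulVec, Matrix.one_mulVec]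

lemma exists_eigen (A : Matrix (Fin 2) (Fin 2) K) (a : K)
    (h : a * a - A.trace * a + A.det = 0) : ∃ v : Fin 2 → K, v ≠ 0 ∧ A *ᵥ v = a • v := by
  rw [← det_sub_smul_one] at h
  obtain ⟨v, hv, h⟩ := Matrix.exists_mulVec_eq_zero_iff.2 h
  exact ⟨v, hv, by rwa [mulVec_sub_smul, sub_eq_zero] at h⟩

lemma eigen_root (A : Matrix (Fin 2) (Fin 2) K) (a : K) (v : Fin 2 → K) (hv : v ≠ 0)
    (h : A *ᵥ v = a • v) : a * a - A.trace * a + A.det = 0 := by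
  rw [← det_sub_smul_one]
  exact Matrix.exists_mulVec_eq_zero_iff.1 ⟨v, hv, by rw [mulVec_sub_smul, h, sub_self]⟩

/-- Two eigenvectors for the same eigenvalue of a matrix with another eigenvalue are
proportional. -/
lemma eigen_unique (A : Matrix (Fin 2) (Fin 2) K) (a b : K) (hab : a ≠ b)
    (u v w : Fin 2 → K) (hu : u ≠ 0) (hw : w ≠ 0)
    (h1 : A *ᵥ u = a • u) (h2 : A *ᵥ v = a • v) (h3 : A *ᵥ w = b • w) :
    ∃ k : K, k • u = v := by
  have e1 : ∀ i, A i 0 * u 0 + A i 1 * u 1 = a * u i := by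
    intro i
    simpa [Matrix.mulVec, dotProduct, Fin.sum_univ_two] using congrFun h1 i
  have e2 : ∀ i, A i 0 * v 0 + A i 1 * v 1 = a * v i := by
    intro i
    simpa [Matrix.mulVec, dotProduct, Fin.sum_univ_two] using congrFun h2 i
  have e3 : ∀ i, A i 0 * w 0 + A i 1 * w 1 = b * w i := by
    intro i
    simpa [Matrix.mulVec, dotProduct, Fin.sum_univ_two] using congrFun h3 i
  have hD : u 0 * v 1 - u 1 * v 0 = 0 := by
    by_contra hD
    apply hw
    have key : ∀ i, (u 0 * v 1 - u 1 * v 0) * ((b - a) * w i) = 0 := by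
      intro i
      have q0 : (u 0 * v 1 - u 1 * v 0) * A i 0 = a * (u i * v 1 - u 1 * v i) := by
        linear_combination (v 1) * e1 i - (u 1) * e2 i
      have q1 : (u 0 * v 1 - u 1 * v 0) * A i 1 = a * (u 0 * v i - u i * v 0) := by
        linear_combination (u 0) * e2 i - (v 0) * e1 i
      have q3 := e3 i
      fin_cases i <;> simp at q0 q1 q3 ⊢ <;> grind
    funext i
    have := key i
    simpa [hD, sub_ne_zero.2 hab.symm] using this
  by_cases h0 : u 0 = 0
  · have h01 : u 1 ≠ 0 := by
      intro h
      apply hu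
      funext i
      fin_cases i <;> simp [h, h0]
    refine ⟨v 1 / u 1, ?_⟩
    funext i
    fin_cases i <;> simp [h0] <;> grind
  · refine ⟨v 0 / u 0, ?_⟩
    funext i
    fin_cases i <;> simp <;> grind

lemma pgl2_fix [IsAlgClosed K] [CharZero K] (g : PGL2 K) (hfin : IsOfFinOrder g) (hg : g ≠ 1) :
    ∃ p q : ℙ K (Fin 2 → K), p ≠ q ∧ ∀ x, g • x = x ↔ x = p ∨ x = q := by
  induction g using QuotientGroup.induction_on with
  | H M =>
  obtain ⟨a, ha⟩ : ∃ a : K, a * a - M.val.trace * a + M.val.det = 0 := by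
    obtain ⟨s, hs⟩ := IsAlgClosed.exists_pow_nat_eq
      (M.val.trace ^ 2 - 4 * M.val.det) (n := 2) two_pos
    refine ⟨(M.val.trace + s) / 2, ?_⟩
    field_simp
    linear_combination hs
  set b := M.val.trace - a with hb
  have hab1 : a + b = M.val.trace := by rw [hb]; ring
  have hab2 : a * b = M.val.det := by rw [hb]; linear_combination -ha
  have hab : a ≠ b := by
    intro h
    rw [← h] at hab1 hab2
    exact hg (mk_eq_one_of_double M a hfin hab1 hab2)
  obtain ⟨u, hu, hu'⟩ := exists_eigen M.val a ha
  obtain ⟨w, hw, hw'⟩ := exists_eigen M.val b (by rw [← hab1, ← hab2]; ring)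
  refine ⟨Projectivization.mk K u hu, Projectivization.mk K w hw, ?_, ?_⟩
  · intro h
    rw [Projectivization.mk_eq_mk_iff'] at h
    obtain ⟨k, rfl⟩ := h
    rw [Matrix.mulVec_smul, hw', smul_comm, ← sub_eq_zero, ← sub_smul] at hu'
    rcases smul_eq_zero.1 hu' with h | h
    · exact hab (sub_eq_zero.1 h).symm
    · exact hu h
  · intro x
    induction x using Projectivization.ind with
    | h v hv =>
    rw [pgl2_smul_eq_iff, Projectivization.mk_eq_mk_iff', Projectivization.mk_eq_mk_iff']
    constructor
    · rintro ⟨c, hc⟩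
      have hr := eigen_root M.val c v hv hc
      have : (c - a) * (c - b) = 0 := by
        rw [← hab1, ← hab2] at hr
        linear_combination hr
      rcases mul_eq_zero.1 this with h | h
      · rw [sub_eq_zero] at h
        subst h
        exact Or.inl (eigen_unique M.val _ b hab u v w hu hw hu' hc hw')
      · rw [sub_eq_zero] at h
        subst h
        exact Or.inr (eigen_unique M.val _ a hab.symm w v u hw hu hw' hc hu')
    · rintro (⟨k, rfl⟩ | ⟨k, rfl⟩)
      · exact ⟨a, by rw [Matrix.mulVec_smul, hu', smul_comm]⟩
      · exact ⟨b, by rw [Matrix.mulVec_smul, hw', smul_comm]⟩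

lemma pgl2_cyclic [CharZero K] (G : Subgroup (PGL2 K)) [Finite G]
    (x : ℙ K (Fin 2 → K)) : IsCyclic (stabilizer G x) := by
  induction x using Projectivization.ind with
  | h v hv =>
  obtain ⟨i, hi⟩ : ∃ i, v i ≠ 0 := by
    by_contra! h
    exact hv (funext h)
  have ex : ∀ h : stabilizer G (Projectivization.mk K v hv), ∃ (M : GL (Fin 2) K) (a : K),
      QuotientGroup.mk M = (h.1.1 : PGL2 K) ∧ M.val *ᵥ v = a • v ∧ a ≠ 0 := by
    intro h
    obtain ⟨M, hM⟩ := QuotientGroup.mk_surjective (h.1.1 : PGL2 K)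
    have h2 : (h.1.1 : PGL2 K) • Projectivization.mk K v hv = Projectivization.mk K v hv := h.2
    rw [← hM, pgl2_smul_eq_iff] at h2
    obtain ⟨a, ha⟩ := h2
    refine ⟨M, a, hM, ha, ?_⟩
    rintro rfl
    have h0 : M.val.det = 0 :=
      Matrix.exists_mulVec_eq_zero_iff.1 ⟨v, hv, by rw [ha, zero_smul]⟩
    have : IsUnit M.val.det := (Matrix.isUnit_iff_isUnit_det _).1 M.isUnit
    rw [h0] at this
    simp at this
  -- the ratio of the two eigenvalues does not depend on the lift
  have indep : ∀ (M M' : GL (Fin 2) K) (a a' : K), a ≠ 0 → a' ≠ 0 →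
      (QuotientGroup.mk M : PGL2 K) = QuotientGroup.mk M' → M.val *ᵥ v = a • v →
      M'.val *ᵥ v = a' • v → M.val.det / a ^ 2 = M'.val.det / a' ^ 2 := by
    intro M M' a a' ha ha' hq h1 h2
    have hq' : (QuotientGroup.mk (M⁻¹ * M') : PGL2 K) = 1 := by
      rw [QuotientGroup.mk_mul, QuotientGroup.mk_inv, hq, inv_mul_cancel]
    obtain ⟨k, hk⟩ := scalar_of_mk_eq_one _ hq'
    have hM' : M'.val = k • M.val := by
      have : M' = M * (M⁻¹ * M') := by group
      rw [this, Units.val_mul, hk, mul_smul_comm, mul_one]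
    rw [hM', Matrix.smul_mulVec, h1, smul_smul] at h2
    have hka : k * a = a' := by
      have := congrFun h2 i
      simp only [Pi.smul_apply, smul_eq_mul] at this
      exact mul_right_cancel₀ hi this
    rw [hM', Matrix.det_smul, Fintype.card_fin, ← hka]
    have hk0 : k ≠ 0 := by
      rintro rfl
      exact ha' (by rw [← hka, zero_mul])
    field_simp
  choose M a hM hMa ha using ex
  let f : stabilizer G (Projectivization.mk K v hv) →* K :=
    { toFun := fun h => (M h).val.det / a h ^ 2
      map_one' := by
        rw [indep (M 1) 1 (a 1) 1 (ha 1) one_ne_zero (by rw [hM]; rfl) (hMa 1) (by simp)]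
        simp
      map_mul' := by
        intro g h
        rw [indep (M (g * h)) (M g * M h) (a (g * h)) (a g * a h) (ha _)
          (mul_ne_zero (ha _) (ha _)) (by rw [hM, QuotientGroup.mk_mul, hM, hM]; rfl) (hMa _)
          (by rw [Units.val_mul, ← Matrix.mulVec_mulVec, hMa, Matrix.mulVec_smul, hMa, smul_smul,
            mul_comm])]
        rw [Units.val_mul, Matrix.det_mul, mul_pow, mul_div_mul_comm] }
  apply isCyclic_of_injective_ringHom f
  rw [injective_iff_map_eq_one]
  intro h hh
  have hdet : (M h).val.det / a h ^ 2 = 1 := hh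
  rw [div_eq_one_iff_eq (pow_ne_zero _ (ha h))] at hdet
  have hr := eigen_root _ _ v hv (hMa h)
  have hfin : IsOfFinOrder (QuotientGroup.mk (M h) : PGL2 K) := by
    rw [hM]
    exact G.subtype.isOfFinOrder (isOfFinOrder_of_finite h.1)
  have h1 := mk_eq_one_of_double (M h) (a h) hfin (by
    rw [hdet] at hr
    apply mul_left_cancel₀ (ha h)
    linear_combination hr) (by rw [hdet]; ring)
  rw [hM] at h1
  exact Subtype.ext (Subtype.ext h1)

end Concrete

/-- Let `K` be an algebraically closed field of characteristic zero and `G` a finite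
subgroup of `PGL(2,K)` that is not isomorphic to a dihedral group `D_m` with `m` even.
Then any two maximal cyclic subgroups of `G` having the same order are conjugate by an
element of `G`. -/
theorem maximal_cyclic_subgroups_conjugate
    (K : Type*) [Field K] [IsAlgClosed K] [CharZero K]
    (G : Subgroup (PGL2 K)) [Finite G]
    (hG : ∀ m : ℕ, Even m → ¬ Nonempty (G ≃* DihedralGroup m))
    (C₁ C₂ : Subgroup ↥G) (h₁ : IsMaximalCyclic C₁) (h₂ : IsMaximalCyclic C₂)
    (hcard : Nat.card C₁ = Nat.card C₂) :
    ∃ g : ↥G, Subgroup.map (MulAut.conj g).toMonoidHom C₁ = C₂ := by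
  refine abstract_conj (X := Projectivization K (Fin 2 → K)) ?_ (pgl2_cyclic G) hG C₁ C₂ h₁ h₂ hcard
  intro g hg
  exact pgl2_fix g.1 (G.subtype.isOfFinOrder (isOfFinOrder_of_finite g))
    (fun h => hg (Subtype.ext h))
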